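/- Let α ≥ 1/2 and let f : (0,1) → [0,∞) satisfy f(γ)/(log(1/(1−γ)))^{1/α} → 0 as γ → 1⁻. Then for every θ₀ ∈ ℝ, sup_{θ ∈ [θ₀−f(γ), θ₀+f(γ)]} |∂S*(θ,γ)/∂θ − 1| → 0 as γ → 1⁻, where ∂S*(θ,γ)/∂θ denotes the derivative of ϑ ↦ S*(ϑ,γ) at θ. -/

import Mathlib

open MeasureTheory Filter Set Topology

/-- Normalization constant `C₀ = (∫ exp(-|x|^α) dx)⁻¹`. -/
noncomputable def C0 (α : ℝ) : ℝ := (∫ x : ℝ, Real.exp (-(|x| ^ α)))⁻¹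

/-- Density `f_θ(x) = C₀ exp(-|x-θ|^α)`. -/
noncomputable def fd (α θ x : ℝ) : ℝ := C0 α * Real.exp (-(|x - θ| ^ α))

/-- Tail probability `P_θ(S) = ∫_S^∞ f_θ(x) dx`. -/
noncomputable def Ptail (α θ S : ℝ) : ℝ := ∫ x in Set.Ioi S, fd α θ x

/-- Conditional mean above `S`: `μ_θ(S) = (∫_S^∞ x f_θ(x) dx) / P_θ(S)`. -/
noncomputable def muTail (α θ S : ℝ) : ℝ := (∫ x in Set.Ioi S, x * fd α θ x) / Ptail α θ S

/-- `g_θ(S) = P_θ(S) / ∫_S^∞ P_θ(x) dx`. -/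
noncomputable def gfun (α θ S : ℝ) : ℝ := Ptail α θ S / ∫ x in Set.Ioi S, Ptail α θ x

/-- Hazard rate `h_θ(S) = f_θ(S)/P_θ(S)`. -/
noncomputable def hazard (α θ S : ℝ) : ℝ := fd α θ S / Ptail α θ S

section IntegralTail

variable {h : ℝ → ℝ}

theorem hasDerivAt_integral_Ioi (hc : Continuous h) (hi : ∀ a, IntegrableOn h (Ioi a)) (t : ℝ) :
    HasDerivAt (fun s => ∫ x in Ioi s, h x) (-h t) t := by
  have h1 : HasDerivAt (fun s => ∫ x in t..s, h x) (h t) t :=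
    intervalIntegral.integral_hasDerivAt_right (hc.intervalIntegrable _ _)
      (hc.stronglyMeasurableAtFilter _ _) hc.continuousAt
  have h2 : (fun s => ∫ x in Ioi s, h x) = fun s => (∫ x in Ioi t, h x) - ∫ x in t..s, h x := by
    funext s
    rw [← intervalIntegral.integral_Ioi_sub_Ioi' (hi t) (hi s)]
    ring
  rw [h2]
  exact h1.const_sub _

theorem strictAnti_integral_Ioi (hc : Continuous h) (hi : ∀ a, IntegrableOn h (Ioi a))
    (hp : ∀ x, 0 < h x) : StrictAnti fun s => ∫ x in Ioi s, h x :=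
  strictAnti_of_hasDerivAt_neg (hasDerivAt_integral_Ioi hc hi) fun x => neg_neg_of_pos (hp x)

theorem integral_Ioi_pos (hc : Continuous h) (hi : ∀ a, IntegrableOn h (Ioi a))
    (hp : ∀ x, 0 < h x) (t : ℝ) : 0 < ∫ x in Ioi t, h x :=
  (setIntegral_nonneg measurableSet_Ioi fun x _ => (hp x).le).trans_lt
    (strictAnti_integral_Ioi hc hi hp (lt_add_one t))

theorem le_integral_Ioi_of_antitoneOn (hc : Continuous h) (hi : ∀ a, IntegrableOn h (Ioi a))
    (hp : ∀ x, 0 ≤ h x) {t : ℝ} (ha : AntitoneOn h (Ici t)) : h (t + 1) ≤ ∫ x in Ioi t, h x := by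
  have h1 := intervalIntegral.integral_Ioi_sub_Ioi (hi t) (le_add_of_nonneg_right zero_le_one :
    t ≤ t + 1)
  have h2 : 0 ≤ ∫ x in Ioi (t + 1), h x := setIntegral_nonneg measurableSet_Ioi fun x _ => hp x
  have h3 : ∫ _ in t..(t + 1), h (t + 1) ≤ ∫ x in t..(t + 1), h x := by
    refine intervalIntegral.integral_mono_on (by linarith) intervalIntegrable_const
      (hc.intervalIntegrable _ _) fun x hx => ?_
    exact ha hx.1 (mem_Ici.2 (by linarith)) hx.2
  simp only [intervalIntegral.integral_const, add_sub_cancel_left, one_smul] at h3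
  linarith

end IntegralTail

theorem nonneg_of_hasDerivAt_nonpos_of_tendsto_zero {φ φ' : ℝ → ℝ} {T : ℝ}
    (hd : ∀ t ≥ T, HasDerivAt φ (φ' t) t) (hn : ∀ t ≥ T, φ' t ≤ 0)
    (hlim : Tendsto φ atTop (𝓝 0)) : ∀ t ≥ T, 0 ≤ φ t := by
  intro t ht
  have ha : AntitoneOn φ (Ici T) := by
    refine antitoneOn_of_hasDerivWithinAt_nonpos (f' := φ') (convex_Ici T)
      (fun x hx => (hd x hx).continuousAt.continuousWithinAt)
      (fun x hx => (hd x (interior_subset hx)).hasDerivWithinAt)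
      fun x hx => hn x (interior_subset hx)
  refine le_of_tendsto hlim ?_
  filter_upwards [eventually_ge_atTop t] with x hx
  exact ha ht (le_trans ht hx) hx

section Density

variable {α : ℝ}

theorem integrable_exp_neg_abs_rpow (hα : 0 < α) :
    Integrable fun x : ℝ => Real.exp (-(|x| ^ α)) := by
  have hc : Continuous fun x : ℝ => Real.exp (-(|x| ^ α)) :=
    Real.continuous_exp.comp (continuous_abs.rpow_const fun _ => Or.inr hα.le).neg
  refine hc.locallyIntegrable.integrable_of_isBigO_atTop_of_norm_isNegInvariant
    (Eventually.of_forall fun x => by simp) (Asymptotics.isBigO_refl _ _) ?_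
  refine ⟨Ioi 0, Ioi_mem_atTop 0, ?_⟩
  refine (integrableOn_rpow_mul_exp_neg_rpow (s := 0) (by norm_num) hα).congr_fun
    (fun x hx => ?_) measurableSet_Ioi
  simp [abs_of_pos (mem_Ioi.1 hx)]

theorem C0_pos (hα : 0 < α) : 0 < C0 α :=
  inv_pos.2 (integral_exp_pos (integrable_exp_neg_abs_rpow hα))

theorem fd_pos (hα : 0 < α) (x : ℝ) : 0 < fd α 0 x :=
  mul_pos (C0_pos hα) (Real.exp_pos _)

theorem fd_of_nonneg {x : ℝ} (hx : 0 ≤ x) : fd α 0 x = C0 α * Real.exp (-(x ^ α)) := by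
  simp [fd, abs_of_nonneg hx]

theorem continuous_fd (hα : 0 < α) : Continuous (fd α 0) := by
  have : Continuous fun x : ℝ => |x - 0| ^ α :=
    (continuous_id.sub continuous_const).abs.rpow_const fun _ => Or.inr hα.le
  exact continuous_const.mul (Real.continuous_exp.comp this.neg)

theorem integrableOn_fd (hα : 0 < α) (a : ℝ) : IntegrableOn (fd α 0) (Ioi a) := by
  have : Integrable (fd α 0) :=
    ((integrable_exp_neg_abs_rpow hα).const_mul (C0 α)).congr
      (Eventually.of_forall fun x => by simp [fd])
  exact this.integrableOn

theorem antitoneOn_fd (hα : 0 < α) : AntitoneOn (fd α 0) (Ici 0) := by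
  intro x hx y hy hxy
  rw [fd_of_nonneg hx, fd_of_nonneg hy]
  have := Real.rpow_le_rpow hx hxy hα.le
  have := (C0_pos hα).le
  gcongr

theorem hasDerivAt_fd {x : ℝ} (hx : 0 < x) :
    HasDerivAt (fd α 0) (-(α * x ^ (α - 1)) * fd α 0 x) x := by
  have h1 : HasDerivAt (fun x : ℝ => C0 α * Real.exp (-(x ^ α)))
      (C0 α * (Real.exp (-(x ^ α)) * -(α * x ^ (α - 1)))) x :=
    ((Real.hasDerivAt_rpow_const (Or.inl hx.ne')).neg.exp).const_mul _
  have h2 : fd α 0 =ᶠ[𝓝 x] fun x : ℝ => C0 α * Real.exp (-(x ^ α)) := by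
    filter_upwards [Ioi_mem_nhds hx] with y hy using fd_of_nonneg (le_of_lt hy)
  refine (h1.congr_of_eventuallyEq h2).congr_deriv ?_
  rw [fd_of_nonneg hx.le]
  ring

theorem tendsto_pow_mul_fd (hα : 0 < α) (n : ℕ) :
    Tendsto (fun x => x ^ n * fd α 0 x) atTop (𝓝 0) := by
  have h1 := ((tendsto_rpow_mul_exp_neg_mul_atTop_nhds_zero (n / α) 1 one_pos).comp
    (tendsto_rpow_atTop hα)).const_mul (C0 α)
  rw [mul_zero] at h1
  refine h1.congr' ?_
  filter_upwards [eventually_gt_atTop 0] with x hx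
  simp only [Function.comp_apply]
  rw [fd_of_nonneg hx.le, ← Real.rpow_mul hx.le, mul_div_cancel₀ _ hα.ne', Real.rpow_natCast,
    neg_one_mul]
  ring

theorem hasDerivAt_Ptail (hα : 0 < α) (t : ℝ) : HasDerivAt (Ptail α 0) (-fd α 0 t) t :=
  hasDerivAt_integral_Ioi (continuous_fd hα) (integrableOn_fd hα) t

theorem Ptail_pos (hα : 0 < α) (t : ℝ) : 0 < Ptail α 0 t :=
  integral_Ioi_pos (continuous_fd hα) (integrableOn_fd hα) (fd_pos hα) t

theorem continuous_Ptail (hα : 0 < α) : Continuous (Ptail α 0) :=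
  continuous_iff_continuousAt.2 fun t => (hasDerivAt_Ptail hα t).continuousAt

theorem eventually_mul_Ptail_le (hα : 0 < α) (M : ℝ) :
    ∃ T > 0, ∀ t ≥ T, M * Ptail α 0 t ≤ t * fd α 0 t := by
  obtain ⟨T, hT⟩ := eventually_atTop.1 (((tendsto_rpow_atTop hα).const_mul_atTop
    hα).eventually_ge_atTop (1 + M))
  refine ⟨max T 1, lt_max_of_lt_right one_pos, fun t ht => ?_⟩
  have hlim : Tendsto (fun t => t * fd α 0 t - M * Ptail α 0 t) atTop (𝓝 0) := by
    have h1 := tendsto_pow_mul_fd hα 1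
    have h2 : Tendsto (Ptail α 0) atTop (𝓝 0) := tendsto_integral_Ioi_zero tendsto_id
    simpa using h1.sub (h2.const_mul M)
  have key := nonneg_of_hasDerivAt_nonpos_of_tendsto_zero (T := max T 1)
    (φ' := fun t => 1 * fd α 0 t + t * (-(α * t ^ (α - 1)) * fd α 0 t) - M * -fd α 0 t)
    (fun s hs => ?_) (fun s hs => ?_) hlim t ht
  · linarith
  · have hs0 : 0 < s := lt_of_lt_of_le (lt_max_of_lt_right one_pos) hs
    exact ((hasDerivAt_id' s).mul (hasDerivAt_fd hs0)).sub ((hasDerivAt_Ptail hα s).const_mul M)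
  · have hs0 : 0 < s := lt_of_lt_of_le (lt_max_of_lt_right one_pos) hs
    have h1 := hT s ((le_max_left _ _).trans hs)
    have h2 : s * s ^ (α - 1) = s ^ α := by
      rw [mul_comm, Real.rpow_sub_one hs0.ne', div_mul_cancel₀ _ hs0.ne']
    have h3 := mul_nonneg (sub_nonneg.2 h1) (fd_pos hα s).le
    have h4 : 1 * fd α 0 s + s * (-(α * s ^ (α - 1)) * fd α 0 s) - M * -fd α 0 s
        = -((α * (s * s ^ (α - 1)) - (1 + M)) * fd α 0 s) := by ring
    simp only [h4, h2]
    linarith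

theorem integrableOn_Ptail (hα : 0 < α) (a : ℝ) : IntegrableOn (Ptail α 0) (Ioi a) := by
  have h1 : IntegrableOn (fun x => x * fd α 0 x) (Ioi 0) := by
    have h0 : IntegrableOn (fun x : ℝ => C0 α * (x ^ (1 : ℝ) * Real.exp (-x ^ α))) (Ioi 0) :=
      (integrableOn_rpow_mul_exp_neg_rpow (by norm_num) hα).const_mul _
    refine h0.congr_fun (fun x hx => ?_) measurableSet_Ioi
    simp only [fd_of_nonneg (le_of_lt (mem_Ioi.1 hx)), Real.rpow_one]
    ring
  have h2 : Ptail α 0 =O[atTop] fun x => x * fd α 0 x := by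
    obtain ⟨T, hT0, hT⟩ := eventually_mul_Ptail_le hα 1
    refine Asymptotics.IsBigO.of_bound 1 ?_
    filter_upwards [eventually_ge_atTop T] with t ht
    rw [Real.norm_of_nonneg (Ptail_pos hα t).le,
      Real.norm_of_nonneg (mul_nonneg (hT0.le.trans ht) (fd_pos hα t).le), one_mul]
    simpa using hT t ht
  exact (((continuous_Ptail hα).locallyIntegrable.locallyIntegrableOn _).integrableOn_of_isBigO_atTop
    h2 ⟨Ioi 0, Ioi_mem_atTop 0, h1⟩).mono_set Ioi_subset_Ici_self

theorem hasDerivAt_integral_Ptail (hα : 0 < α) (t : ℝ) :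
    HasDerivAt (fun s => ∫ x in Ioi s, Ptail α 0 x) (-Ptail α 0 t) t :=
  hasDerivAt_integral_Ioi (continuous_Ptail hα) (integrableOn_Ptail hα) t

theorem eventually_mul_integral_Ptail_le (hα : 0 < α) (M : ℝ) :
    ∃ T > 0, ∀ t ≥ T, M * ∫ x in Ioi t, Ptail α 0 x ≤ t * Ptail α 0 t := by
  obtain ⟨T, hT0, hT⟩ := eventually_mul_Ptail_le hα (1 + M)
  obtain ⟨T', hT'0, hT'⟩ := eventually_mul_Ptail_le hα 1
  refine ⟨T, hT0, fun t ht => ?_⟩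
  have hlim : Tendsto (fun t => t * Ptail α 0 t - M * ∫ x in Ioi t, Ptail α 0 x) atTop (𝓝 0) := by
    have h1 : Tendsto (fun t => t * Ptail α 0 t) atTop (𝓝 0) := by
      refine squeeze_zero' ?_ ?_ (tendsto_pow_mul_fd hα 2)
      · filter_upwards [eventually_ge_atTop 0] with t ht using mul_nonneg ht (Ptail_pos hα t).le
      · filter_upwards [eventually_ge_atTop T'] with t ht
        have h0 : 0 ≤ t := hT'0.le.trans ht
        calc t * Ptail α 0 t ≤ t * (t * fd α 0 t) :=
              mul_le_mul_of_nonneg_left (by simpa using hT' t ht) h0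
          _ = t ^ 2 * fd α 0 t := by ring
    have h2 : Tendsto (fun t => ∫ x in Ioi t, Ptail α 0 x) atTop (𝓝 0) :=
      tendsto_integral_Ioi_zero tendsto_id
    simpa using h1.sub (h2.const_mul M)
  have key := nonneg_of_hasDerivAt_nonpos_of_tendsto_zero (T := T)
    (φ' := fun t => 1 * Ptail α 0 t + t * -fd α 0 t - M * -Ptail α 0 t)
    (fun s _ => ((hasDerivAt_id' s).mul (hasDerivAt_Ptail hα s)).sub
      ((hasDerivAt_integral_Ptail hα s).const_mul M))
    (fun s hs => by linarith [hT s hs]) hlim t ht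
  simpa using key

theorem fd_add_two_le_integral_Ptail (hα : 0 < α) {t : ℝ} (ht : 0 ≤ t) :
    fd α 0 (t + 2) ≤ ∫ x in Ioi t, Ptail α 0 x := by
  have h1 := le_integral_Ioi_of_antitoneOn (t := t + 1) (continuous_fd hα) (integrableOn_fd hα)
    (fun x => (fd_pos hα x).le) ((antitoneOn_fd hα).mono (Ici_subset_Ici.2 (by linarith)))
  have h2 := le_integral_Ioi_of_antitoneOn (t := t) (continuous_Ptail hα) (integrableOn_Ptail hα)
    (fun x => (Ptail_pos hα x).le)
    ((strictAnti_integral_Ioi (continuous_fd hα) (integrableOn_fd hα)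
      (fd_pos hα)).antitone.antitoneOn _)
  rw [add_assoc, one_add_one_eq_two] at h1
  exact h1.trans h2

theorem setIntegral_Ioi_comp_sub (g : ℝ → ℝ) (θ S : ℝ) :
    ∫ x in Ioi S, g (x - θ) = ∫ x in Ioi (S - θ), g x := by
  rw [← (measurePreserving_sub_right volume θ).setIntegral_preimage_emb
    (Homeomorph.subRight θ).measurableEmbedding g (Ioi (S - θ))]
  simp

theorem Ptail_eq_Ptail_zero (θ S : ℝ) : Ptail α θ S = Ptail α 0 (S - θ) := by
  rw [Ptail, Ptail, ← setIntegral_Ioi_comp_sub]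
  simp [fd]

theorem integral_Ptail_eq (θ S : ℝ) :
    ∫ x in Ioi S, Ptail α θ x = ∫ x in Ioi (S - θ), Ptail α 0 x := by
  simp_rw [Ptail_eq_Ptail_zero θ]
  exact setIntegral_Ioi_comp_sub _ θ S

/-- Implicit differentiation of `k * s θ = ∫_{s θ - θ}^∞ P₀`. -/
theorem hasDerivAt_of_fixedPoint (hα : 0 < α) {k : ℝ} (hk : 0 < k) {s : ℝ → ℝ}
    (hs : ∀ θ, k * s θ = ∫ x in Ioi (s θ - θ), Ptail α 0 x) (θ : ℝ) :
    HasDerivAt s (1 - k / (k + Ptail α 0 (s θ - θ))) θ := by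
  set Θ : ℝ → ℝ := fun t => (∫ x in Ioi t, Ptail α 0 x) / k - t with hΘ
  have hd : ∀ t, HasDerivAt Θ (-Ptail α 0 t / k - 1) t := fun t =>
    ((hasDerivAt_integral_Ptail hα t).div_const k).sub (hasDerivAt_id' t)
  have hneg : ∀ t, -Ptail α 0 t / k - 1 < 0 := fun t => by
    have := div_pos (Ptail_pos hα t) hk
    rw [neg_div]
    linarith
  have hΘs : ∀ ϑ, Θ (s ϑ - ϑ) = ϑ := fun ϑ => by
    simp only [hΘ, ← hs ϑ]
    field_simp
    ring
  have hinv : ∀ t, s (Θ t) - Θ t = t := fun t =>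
    (strictAnti_of_hasDerivAt_neg hd hneg).injective (hΘs (Θ t))
  have hstrict : HasStrictDerivAt Θ (-Ptail α 0 (s θ - θ) / k - 1) (s θ - θ) :=
    hasStrictDerivAt_of_hasDerivAt_of_continuousAt (f' := fun t => -Ptail α 0 t / k - 1)
      (Eventually.of_forall hd)
      (((continuous_Ptail hα).neg.div_const k).sub continuous_const).continuousAt
  have h1 := (hstrict.to_local_left_inverse (hneg _).ne (g := fun ϑ => s ϑ - ϑ)
    (Eventually.of_forall hinv)).hasDerivAt
  rw [hΘs] at h1
  have h2 := h1.add (hasDerivAt_id' θ)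
  convert! h2 using 1
  · funext ϑ
    simp
  · have hP := Ptail_pos hα (s θ - θ)
    have e : -Ptail α 0 (s θ - θ) / k - 1 = -((k + Ptail α 0 (s θ - θ)) / k) := by
      field_simp
      ring
    rw [e, inv_neg, inv_div]
    ring

end Density

theorem tendsto_log_one_div_one_sub :
    Tendsto (fun γ : ℝ => Real.log (1 / (1 - γ))) (𝓝[<] 1) atTop := by
  have h1 : Tendsto (fun γ : ℝ => 1 - γ) (𝓝[<] 1) (𝓝[>] 0) := by
    refine tendsto_nhdsWithin_iff.2 ⟨?_, ?_⟩
    · have : Tendsto (fun γ : ℝ => 1 - γ) (𝓝 1) (𝓝 (1 - 1)) :=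
        (continuous_const.sub continuous_id).tendsto 1
      rw [sub_self] at this
      exact this.mono_left nhdsWithin_le_nhds
    · filter_upwards [self_mem_nhdsWithin] with γ hγ
      exact sub_pos.2 (mem_Iio.1 hγ)
  simp_rw [one_div]
  exact Real.tendsto_log_atTop.comp (tendsto_inv_nhdsGT_zero.comp h1)

/-- If `k` is small compared with the tail integral near `(L / 2) ^ (1 / α)`, the fixed point lies
to the right of that threshold. -/
theorem le_of_fixedPoint {α : ℝ} (hα : 0 < α) {k t t₀ θ : ℝ} (hk : 0 < k) (ht₀ : 0 ≤ t₀)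
    (hfix : k * (t + θ) = ∫ x in Ioi t, Ptail α 0 x) (hle : k * (t₀ + θ) ≤ fd α 0 (t₀ + 2)) :
    t₀ ≤ t := by
  by_contra! hlt
  have h1 := strictAnti_integral_Ioi (continuous_Ptail hα) (integrableOn_Ptail hα) (Ptail_pos hα) hlt
  have h2 := fd_add_two_le_integral_Ptail hα ht₀
  have h3 : k * (t + θ) < k * (t₀ + θ) := by gcongr
  simp only at h1
  linarith

/-- Uniform convergence of `∂S*(θ,γ)/∂θ` to `1` for `θ ∈ [θ₀−f(γ), θ₀+f(γ)]`
as `γ → 1⁻`. -/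
theorem stmt_10 (α : ℝ) (hα : 1/2 ≤ α)
    (Sstar : ℝ → ℝ → ℝ)
    (hS : ∀ θ : ℝ, ∀ γ ∈ Set.Ioo (0:ℝ) 1,
      0 < Sstar θ γ ∧
      ((1-γ)/γ) * Sstar θ γ = (∫ x in Set.Ioi (Sstar θ γ), Ptail α θ x) ∧
      ∀ S, 0 < S → ((1-γ)/γ) * S = (∫ x in Set.Ioi S, Ptail α θ x) → S = Sstar θ γ)
    (f : ℝ → ℝ) (hf0 : ∀ γ, 0 ≤ f γ)
    (hf : Tendsto (fun γ => f γ / (Real.log (1/(1-γ))) ^ (1/α)) (𝓝[<] (1:ℝ)) (𝓝 0))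
    (θ₀ : ℝ) :
    ∀ c > 0, ∀ᶠ γ in 𝓝[<] (1:ℝ), ∀ θ ∈ Set.Icc (θ₀ - f γ) (θ₀ + f γ),
      |deriv (fun ϑ => Sstar ϑ γ) θ - 1| ≤ c := by
  intro c hc
  have hα0 : 0 < α := by linarith
  set L : ℝ → ℝ := fun γ => Real.log (1 / (1 - γ)) with hL
  have hLtop : Tendsto L (𝓝[<] 1) atTop := tendsto_log_one_div_one_sub
  set y : ℝ → ℝ := fun γ => L γ ^ (1 / α) with hy
  have hytop : Tendsto y (𝓝[<] 1) atTop := (tendsto_rpow_atTop (one_div_pos.2 hα0)).comp hLtop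
  obtain ⟨a, ha0, haα⟩ : ∃ a : ℝ, 0 < a ∧ a ^ α = 1 / 2 :=
    ⟨(1 / 2) ^ (1 / α), by positivity, by
      rw [← Real.rpow_mul (by norm_num), one_div_mul_cancel hα0.ne', Real.rpow_one]⟩
  obtain ⟨T, hT0, hT⟩ := eventually_mul_integral_Ptail_le hα0 (2 / c)
  have hsmall : Tendsto (fun γ => 4 * a * (y γ * Real.exp (-(1 / 2) * L γ))) (𝓝[<] 1) (𝓝 0) := by
    rw [← mul_zero (4 * a)]
    exact ((tendsto_rpow_mul_exp_neg_mul_atTop_nhds_zero (1 / α) (1 / 2)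
      (by norm_num)).comp hLtop).const_mul (4 * a)
  filter_upwards [Ioo_mem_nhdsLT (show (1 / 2 : ℝ) < 1 by norm_num),
    hLtop.eventually_gt_atTop 0,
    (hytop.const_mul_atTop ha0).eventually_ge_atTop (max 4 (max (2 * T) (8 * |θ₀|))),
    hf.eventually_le_const (show 0 < a / 8 by positivity),
    hsmall.eventually_le_const (C0_pos hα0)] with γ hγ hLpos hybig hfy hexp θ hθ
  change f γ / y γ ≤ a / 8 at hfy
  obtain ⟨hγ1, hγ2⟩ := hγ
  have hγ0 : γ ∈ Ioo (0 : ℝ) 1 := ⟨by linarith, hγ2⟩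
  have hypos : 0 < y γ := Real.rpow_pos_of_pos hLpos _
  rw [div_le_iff₀ hypos] at hfy
  simp only [max_le_iff] at hybig
  obtain ⟨hy4, hyT, hyθ⟩ := hybig
  have hθabs : |θ| ≤ a * y γ / 4 := by
    have h0 := abs_le.1 (le_refl |θ₀|)
    rw [abs_le]
    constructor <;> linarith [hθ.1, hθ.2, h0.1, h0.2]
  obtain ⟨hθl, hθu⟩ := abs_le.1 hθabs
  set k : ℝ := (1 - γ) / γ with hk
  have hkpos : 0 < k := div_pos (by linarith) hγ0.1
  have hfix : ∀ ϑ, k * Sstar ϑ γ = ∫ x in Ioi (Sstar ϑ γ - ϑ), Ptail α 0 x := fun ϑ => by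
    rw [← integral_Ptail_eq]
    exact (hS ϑ γ hγ0).2.1
  rw [(hasDerivAt_of_fixedPoint hα0 hkpos hfix θ).deriv]
  set t : ℝ := Sstar θ γ - θ with ht
  have hSt : t + θ = Sstar θ γ := by rw [ht]; ring
  have hfixt : k * (t + θ) = ∫ x in Ioi t, Ptail α 0 x := by rw [hSt]; exact hfix θ
  have hexpL : Real.exp (-L γ) = 1 - γ := by
    rw [hL]
    simp only [one_div, Real.log_inv, neg_neg]
    exact Real.exp_log (by linarith)
  have hk2 : k ≤ 2 * Real.exp (-L γ) := by
    rw [hexpL, hk, div_le_iff₀ hγ0.1]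
    nlinarith
  have hfd : fd α 0 (a * y γ - 2 + 2) = C0 α * Real.exp (-(1 / 2) * L γ) := by
    have hyα : y γ ^ α = L γ := by
      rw [hy]
      simp only
      rw [← Real.rpow_mul hLpos.le, one_div_mul_cancel hα0.ne', Real.rpow_one]
    rw [sub_add_cancel, fd_of_nonneg (by positivity), Real.mul_rpow ha0.le hypos.le, haα, hyα,
      neg_mul]
  have ht0 : a * y γ - 2 ≤ t := by
    refine le_of_fixedPoint hα0 hkpos (by linarith) hfixt ?_
    rw [hfd]
    have hsplit : Real.exp (-L γ) = Real.exp (-(1 / 2) * L γ) * Real.exp (-(1 / 2) * L γ) := by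
      rw [← Real.exp_add]
      ring_nf
    calc k * (a * y γ - 2 + θ) ≤ (2 * Real.exp (-L γ)) * (2 * (a * y γ)) := by
          gcongr
          · linarith
          · linarith
      _ = 4 * a * (y γ * Real.exp (-(1 / 2) * L γ)) * Real.exp (-(1 / 2) * L γ) := by
          rw [hsplit]
          ring
      _ ≤ C0 α * Real.exp (-(1 / 2) * L γ) := by gcongr
  have htpos : 0 < t := by linarith
  have hP := Ptail_pos hα0 t
  have hmain := hT t (by linarith)
  rw [← hfixt] at hmain
  have hkP : k / c ≤ Ptail α 0 t := by
    refine le_of_mul_le_mul_left ?_ htpos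
    calc t * (k / c) = 2 / c * (k * (t / 2)) := by ring
      _ ≤ 2 / c * (k * (t + θ)) := by
          gcongr
          linarith
      _ ≤ t * Ptail α 0 t := hmain
  rw [div_le_iff₀ hc] at hkP
  rw [sub_sub_cancel_left, abs_neg, abs_of_nonneg (by positivity), div_le_iff₀ (by positivity)]
  nlinarith
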